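/- arXiv:2212.00077 — 2 statements merged into one kernel-verified Lean document; each statement's English description precedes it below -/
import Mathlib

section
/- Let k be a field and let m ≥ n ≥ 1 be integers. The double cosets P_{mn−1,1}(k)·ε_r·T_{m,n}(k), for 0 ≤ r ≤ n−1, are pairwise distinct and their union is all of GL_{mn}(k). Hence the double coset space P_{mn−1,1}(k)\GL_{mn}(k)/T_{m,n}(k) has exactly n elements, with representatives ε_0, …, ε_{n−1}. -/
open Matrix

/-- Kronecker product of square matrices, realized on `Fin (m * n)`:
the `(i,j)` block of size `n` is `h i j • g`. -/
def kron {k : Type*} [Field k] {m n : ℕ} (h : Matrix (Fin m) (Fin m) k)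
    (g : Matrix (Fin n) (Fin n) k) : Matrix (Fin (m * n)) (Fin (m * n)) k :=
  Matrix.of fun x y => h x.divNat y.divNat * g x.modNat y.modNat

/-- `T_{m,n}(k)`: the image of the Kronecker product map on invertible matrices. -/
def TSet (k : Type*) [Field k] (m n : ℕ) : Set (Matrix (Fin (m * n)) (Fin (m * n)) k) :=
  {A | ∃ (h : Matrix (Fin m) (Fin m) k) (g : Matrix (Fin n) (Fin n) k),
    IsUnit h.det ∧ IsUnit g.det ∧ A = kron h g}

/-- `P_{N-1,1}(k)`: invertible `N × N` matrices whose last row is `(0,…,0,d)`, `d ≠ 0`. -/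
def ParabP (k : Type*) [Field k] (N : ℕ) : Set (Matrix (Fin N) (Fin N) k) :=
  {A | IsUnit A.det ∧ ∀ i j : Fin N, (i : ℕ) = N - 1 → (j : ℕ) ≠ N - 1 → A i j = 0}

/-- The permutation matrix `w_j` (with `1 ≤ j ≤ N`), given in block form by rows
`((I_{j−1},0,0),(0,0,I_{N−j}),(0,1,0))`, the middle column block having width 1. -/
def wMat (k : Type*) [Field k] (N j : ℕ) : Matrix (Fin N) (Fin N) k :=
  Matrix.of fun i l =>
    if (l : ℕ) = (if (i : ℕ) + 1 < j then (i : ℕ)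
                  else if (i : ℕ) + 1 < N then (i : ℕ) + 1 else j - 1)
    then 1 else 0

/-- The unipotent matrix `u_j(v)` (with `1 ≤ j ≤ N`, `v` a row vector of length `N - j`):
the identity except that its `j`-th row is `(0,…,0,1,v)` with the `1` in position `j`. -/
def uMat (k : Type*) [Field k] (N j : ℕ) (v : Fin (N - j) → k) : Matrix (Fin N) (Fin N) k :=
  Matrix.of fun i l =>
    if (i : ℕ) = j - 1 then
      (if (l : ℕ) = j - 1 then 1
       else if h : j ≤ (l : ℕ) then v ⟨(l : ℕ) - j, by have := l.isLt; omega⟩ else 0)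
    else if l = i then 1 else 0

/-- The row vector `b_r ∈ k^{rn}` given by concatenating the standard basis row vectors
`e_{n-1}, e_{n-2}, …, e_{n-r}` of `k^n`: its block `p` (0-based) is `e_{n-1-p}`. -/
def bVec (k : Type*) [Field k] (n : ℕ) {M : ℕ} : Fin M → k :=
  fun i => if (i : ℕ) % n + (i : ℕ) / n + 2 = n then 1 else 0

/-- The representative `ε_r := w_{(m−r)n} · u_{(m−r)n}(b_r) ∈ GL_{mn}(k)`. -/
def epsMat (k : Type*) [Field k] (m n r : ℕ) : Matrix (Fin (m * n)) (Fin (m * n)) k :=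
  wMat k (m * n) ((m - r) * n) * uMat k (m * n) ((m - r) * n) (bVec k n)

/-- The double coset `P_{mn−1,1}(k) · A · T_{m,n}(k)`. -/
def dCoset (k : Type*) [Field k] (m n : ℕ) (A : Matrix (Fin (m * n)) (Fin (m * n)) k) :
    Set (Matrix (Fin (m * n)) (Fin (m * n)) k) :=
  {X | ∃ p ∈ ParabP k (m * n), ∃ t ∈ TSet k m n, X = p * A * t}

/-- Two linear maps of the same rank between finite-dimensional spaces differ by automorphisms
of the source and of the target. -/
theorem LinearMap.exists_linearEquiv_of_finrank_range_eq {k V W : Type*} [Field k]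
    [AddCommGroup V] [Module k V] [FiniteDimensional k V]
    [AddCommGroup W] [Module k W] [FiniteDimensional k W] (f g : V →ₗ[k] W)
    (hfg : Module.finrank k (LinearMap.range f) = Module.finrank k (LinearMap.range g)) :
    ∃ (a : V ≃ₗ[k] V) (b : W ≃ₗ[k] W), ∀ v, g (a v) = b (f v) := by
  have split (f : V →ₗ[k] W) : ∃ e : (LinearMap.ker f × LinearMap.range f) ≃ₗ[k] V,
      ∀ x, f (e x) = x.2 := by
    obtain ⟨q, hq⟩ := (LinearMap.ker f).exists_isCompl
    refine ⟨(LinearEquiv.refl k _).prodCongr (f.kerComplementEquivRange hq.symm).symm ≪≫ₗ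
      Submodule.prodEquivOfIsCompl _ _ hq, fun x => ?_⟩
    have hx := congrArg Subtype.val
      ((f.kerComplementEquivRange hq.symm).apply_symm_apply x.2)
    simpa using hx
  obtain ⟨ef, hef⟩ := split f
  obtain ⟨eg, heg⟩ := split g
  let φ := LinearEquiv.ofFinrankEq _ _ hfg
  have hker : Module.finrank k (LinearMap.ker f) = Module.finrank k (LinearMap.ker g) := by
    have := f.finrank_range_add_finrank_ker
    have := g.finrank_range_add_finrank_ker
    omega
  obtain ⟨b, hb⟩ := Submodule.exists_linearEquiv_restrict_eq φ
  refine ⟨ef.symm ≪≫ₗ (LinearEquiv.ofFinrankEq _ _ hker).prodCongr φ ≪≫ₗ eg, b, fun v => ?_⟩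
  obtain ⟨x, rfl⟩ := ef.surjective v
  simp [heg, hef, hb]

theorem Matrix.isUnit_det_toMatrix' {k ι : Type*} [Field k] [Fintype ι] [DecidableEq ι]
    (a : (ι → k) ≃ₗ[k] (ι → k)) : IsUnit (LinearMap.toMatrix' (a : (ι → k) →ₗ[k] ι → k)).det := by
  rw [LinearMap.det_toMatrix']
  exact a.isUnit_det'

/-- Matrices of the same size and rank over a field are equivalent. -/
theorem Matrix.exists_mul_mul_eq_of_rank_eq {k : Type*} [Field k] {ι κ : Type*}
    [Fintype ι] [DecidableEq ι] [Fintype κ] [DecidableEq κ] (X Y : Matrix ι κ k)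
    (hXY : X.rank = Y.rank) :
    ∃ (h : Matrix ι ι k) (g : Matrix κ κ k), IsUnit h.det ∧ IsUnit g.det ∧ X = h * Y * g := by
  obtain ⟨a, b, hab⟩ :=
    LinearMap.exists_linearEquiv_of_finrank_range_eq Y.mulVecLin X.mulVecLin hXY.symm
  refine ⟨LinearMap.toMatrix' (b : (ι → k) →ₗ[k] ι → k),
    LinearMap.toMatrix' (a.symm : (κ → k) →ₗ[k] κ → k),
    Matrix.isUnit_det_toMatrix' b, Matrix.isUnit_det_toMatrix' a.symm, ?_⟩
  apply Matrix.toLin'.injective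
  ext1 j
  ext1
  have := hab (a.symm (Pi.single j 1))
  simp only [LinearEquiv.apply_symm_apply, mulVecLin_apply] at this
  simp [Matrix.toLin'_mul, this]

theorem kron_eq_submatrix {k : Type*} [Field k] {m n : ℕ} (h : Matrix (Fin m) (Fin m) k)
    (g : Matrix (Fin n) (Fin n) k) :
    kron h g = (kroneckerMap (· * ·) h g).submatrix finProdFinEquiv.symm finProdFinEquiv.symm :=
  rfl

theorem kron_one_one {k : Type*} [Field k] {m n : ℕ} :
    kron (1 : Matrix (Fin m) (Fin m) k) (1 : Matrix (Fin n) (Fin n) k) = 1 := by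
  rw [kron_eq_submatrix, one_kronecker_one, submatrix_one_equiv]

theorem isUnit_det_kron {k : Type*} [Field k] {m n : ℕ} {h : Matrix (Fin m) (Fin m) k}
    {g : Matrix (Fin n) (Fin n) k} (hh : IsUnit h.det) (hg : IsUnit g.det) :
    IsUnit (kron h g).det := by
  rw [kron_eq_submatrix, det_submatrix_equiv_self, det_kronecker]
  exact (hh.pow _).mul (hg.pow _)

/-- Row `z` of an `mn × mn` matrix, cut into `m` consecutive pieces of length `n` which are
stacked as the rows of an `m × n` matrix. -/
def rowBlocks {k : Type*} {m n : ℕ} (z : Fin (m * n)) (A : Matrix (Fin (m * n)) (Fin (m * n)) k) :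
    Matrix (Fin m) (Fin n) k :=
  Matrix.of fun i j => A z (finProdFinEquiv (i, j))

theorem rowBlocks_inj {k : Type*} {m n : ℕ} {z : Fin (m * n)}
    {A B : Matrix (Fin (m * n)) (Fin (m * n)) k} (hAB : rowBlocks z A = rowBlocks z B) :
    A z = B z := by
  funext y
  obtain ⟨⟨i, j⟩, rfl⟩ := finProdFinEquiv.surjective y
  exact congrFun₂ hAB i j

theorem rowBlocks_mul_kron {k : Type*} [Field k] {m n : ℕ} (z : Fin (m * n))
    (A : Matrix (Fin (m * n)) (Fin (m * n)) k) (h : Matrix (Fin m) (Fin m) k)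
    (g : Matrix (Fin n) (Fin n) k) :
    rowBlocks z (A * kron h g) = hᵀ * rowBlocks z A * g := by
  ext i j
  simp only [rowBlocks, of_apply, mul_apply, kron_eq_submatrix, submatrix_apply,
    Equiv.symm_apply_apply, kroneckerMap_apply, transpose_apply, Finset.sum_mul]
  rw [← finProdFinEquiv.sum_comp, Fintype.sum_prod_type_right]
  simp only [Equiv.symm_apply_apply]
  exact Finset.sum_congr rfl fun _ _ => Finset.sum_congr rfl fun _ _ => by ring

theorem one_mem_ParabP (k : Type*) [Field k] (N : ℕ) :
    (1 : Matrix (Fin N) (Fin N) k) ∈ ParabP k N :=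
  ⟨by simp, fun _ _ hi hj => one_apply_ne fun hij => hj (hij ▸ hi)⟩

theorem row_mul_of_mem_ParabP {k : Type*} [Field k] {N : ℕ} {p : Matrix (Fin N) (Fin N) k}
    (hp : p ∈ ParabP k N) {z : Fin N} (hz : (z : ℕ) = N - 1) (A : Matrix (Fin N) (Fin N) k) :
    (p * A) z = p z z • A z := by
  funext y
  rw [mul_apply, Finset.sum_eq_single z]
  · rfl
  · intro b _ hb
    rw [hp.2 z b hz fun h => hb (Fin.ext (h.trans hz.symm)), zero_mul]
  · simp

theorem apply_last_ne_zero_of_mem_ParabP {k : Type*} [Field k] {N : ℕ}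
    {p : Matrix (Fin N) (Fin N) k} (hp : p ∈ ParabP k N) {z : Fin N} (hz : (z : ℕ) = N - 1) :
    p z z ≠ 0 := by
  intro h0
  refine hp.1.ne_zero (det_eq_zero_of_row_eq_zero z fun j => ?_)
  by_cases hj : (j : ℕ) = N - 1
  · rwa [show j = z from Fin.ext (hj.trans hz.symm)]
  · exact hp.2 z j hz hj

/-- Invertible matrices with the same last row differ by an element of the parabolic subgroup. -/
theorem exists_mem_ParabP_of_row_eq {k : Type*} [Field k] {N : ℕ} {A B : Matrix (Fin N) (Fin N) k}
    (hA : IsUnit A.det) (hB : IsUnit B.det) {z : Fin N} (hz : (z : ℕ) = N - 1) (hAB : A z = B z) :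
    ∃ p ∈ ParabP k N, A = p * B := by
  refine ⟨A * B⁻¹, ⟨?_, fun i j hi hj => ?_⟩, ?_⟩
  · rw [det_mul]
    exact hA.mul (isUnit_nonsing_inv_det B hB)
  · obtain rfl : i = z := Fin.ext (hi.trans hz.symm)
    have hij : i ≠ j := fun h => hj (h ▸ hi)
    calc (A * B⁻¹) i j = (B * B⁻¹) i j := by simp only [mul_apply, hAB]
      _ = 0 := by rw [mul_nonsing_inv B hB, one_apply_ne hij]
  · rw [Matrix.mul_assoc, nonsing_inv_mul B hB, Matrix.mul_one]

theorem isUnit_det_wMat (k : Type*) [Field k] {N j : ℕ} (hj : 1 ≤ j) :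
    IsUnit (wMat k N j).det := by
  let f : Fin N → Fin N := fun i => ⟨if (i : ℕ) + 1 < j then (i : ℕ)
    else if (i : ℕ) + 1 < N then (i : ℕ) + 1 else j - 1, by split_ifs <;> omega⟩
  have hf : Function.Injective f := by
    intro a b hab
    have := congrArg Fin.val hab
    simp only [f] at this
    ext
    split_ifs at this <;> omega
  have hw : wMat k N j * (wMat k N j)ᵀ = 1 := by
    have hwf : wMat k N j = Matrix.of fun i l => if l = f i then 1 else 0 := by
      ext i l
      simp [wMat, f, Fin.ext_iff]
    ext a b
    simp [hwf, mul_apply, one_apply, hf.eq_iff, eq_comm (a := b)]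
  exact isUnit_det_of_right_inverse hw

theorem isUnit_det_uMat (k : Type*) [Field k] {N j : ℕ} (hj : 1 ≤ j) (v : Fin (N - j) → k) :
    IsUnit (uMat k N j v).det := by
  have htri : (uMat k N j v).IsUpperTriangular := by
    intro a b hab
    have hab' : (b : ℕ) < a := hab
    simp only [uMat, of_apply]
    split_ifs <;> first | rfl | omega
  rw [det_of_isUpperTriangular htri, Finset.prod_eq_one]
  · exact isUnit_one
  · intro i _
    simp +contextual [uMat]

theorem isUnit_det_epsMat (k : Type*) [Field k] {m n r : ℕ} (hn : 1 ≤ n) (hr : r < m) :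
    IsUnit (epsMat k m n r).det := by
  have hj : 1 ≤ (m - r) * n := Nat.mul_pos (by omega) hn
  rw [epsMat, det_mul]
  exact (isUnit_det_wMat k hj).mul (isUnit_det_uMat k hj _)

theorem wMat_mul_last {k : Type*} [Field k] {N j : ℕ} (hj : 1 ≤ j) (hjN : j ≤ N) {z : Fin N}
    (hz : (z : ℕ) = N - 1) (A : Matrix (Fin N) (Fin N) k) (y : Fin N) :
    (wMat k N j * A) z y = A ⟨j - 1, by omega⟩ y := by
  rw [mul_apply, Finset.sum_eq_single ⟨j - 1, by omega⟩]
  · have h₁ : ¬ (z : ℕ) + 1 < j := by omega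
    have h₂ : ¬ (z : ℕ) + 1 < N := by omega
    simp [wMat, h₁, h₂]
  · intro b _ hb
    have h₁ : ¬ (z : ℕ) + 1 < j := by omega
    have h₂ : ¬ (z : ℕ) + 1 < N := by omega
    have h₃ : (b : ℕ) ≠ j - 1 := fun h => hb (Fin.ext h)
    simp [wMat, h₁, h₂, h₃]
  · simp

/-- The last row of `ε_r`, in blocks, has ones on a single antidiagonal. -/
theorem rowBlocks_epsMat {k : Type*} [Field k] {m n r : ℕ} (hr : r < n) (hnm : n ≤ m)
    {z : Fin (m * n)} (hz : (z : ℕ) = m * n - 1) (i : Fin m) (j : Fin n) :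
    rowBlocks z (epsMat k m n r) i j = if (i : ℕ) + j + r + 2 = n + m then 1 else 0 := by
  obtain ⟨q, rfl⟩ : ∃ q, m = q + 1 + r := ⟨m - 1 - r, by omega⟩
  have hq : q + 1 + r - r = q + 1 := by omega
  have hj := j.isLt
  have hle : (q + 1) * n ≤ (q + 1 + r) * n := Nat.mul_le_mul_right n (by omega)
  have hpos : 1 ≤ (q + 1) * n := Nat.mul_pos (by omega) (by omega)
  rw [rowBlocks, of_apply, epsMat, hq, wMat_mul_last hpos hle hz]
  simp only [uMat, of_apply, if_true, bVec, finProdFinEquiv_apply_val]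
  have hexp : (q + 1) * n = n * q + n := by ring
  rcases lt_trichotomy (i : ℕ) q with hi | hi | hi
  · obtain ⟨c, hc⟩ : ∃ c, q = i + 1 + c := ⟨q - 1 - i, by omega⟩
    have : n * q = n * i + n + n * c := by
      linear_combination n * hc
    rw [if_neg (by omega), dif_neg (by omega), if_neg (by omega)]
  · rw [hi, dif_neg (by omega)]
    simp only [hexp]
    congr 1
    exact propext (by omega)
  · obtain ⟨c, hc⟩ : ∃ c, (i : ℕ) = q + 1 + c := ⟨i - 1 - q, by omega⟩
    have : n * i = n * q + n + n * c := by rw [hc]; ring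
    have hsub : (j : ℕ) + n * i - (q + 1) * n = j + n * c := by omega
    rw [if_neg (by omega), dif_pos (by omega), hsub, Nat.add_mul_mod_self_left,
      Nat.mod_eq_of_lt hj, Nat.add_mul_div_left _ _ (by omega), Nat.div_eq_of_lt hj]
    congr 1
    exact propext (by omega)

theorem rank_rowBlocks_epsMat {k : Type*} [Field k] {m n r : ℕ} (hr : r < n) (hnm : n ≤ m)
    {z : Fin (m * n)} (hz : (z : ℕ) = m * n - 1) :
    (rowBlocks z (epsMat k m n r)).rank = r + 1 := by
  classical
  set X := rowBlocks z (epsMat k m n r)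
  have hXij (i : Fin m) (j : Fin n) : X i j = if (i : ℕ) + j + r + 2 = n + m then 1 else 0 :=
    rowBlocks_epsMat hr hnm hz i j
  let D : Matrix (Fin m) (Fin m) k := diagonal fun i => if m ≤ i + r + 1 then 1 else 0
  have hD : D.rank = r + 1 := by
    have hcard : Fintype.card {i : Fin m // m ≤ i + r + 1} = Fintype.card (Fin (r + 1)) :=
      Fintype.card_congr
        { toFun := fun i => ⟨i.1 + r + 1 - m, by omega⟩
          invFun := fun t => ⟨⟨m - (r + 1) + t, by omega⟩, by simp only; omega⟩
          left_inv := fun i => by ext; have := i.2; simp only; omega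
          right_inv := fun t => by ext; simp only; omega }
    rw [rank_diagonal]
    simpa using hcard
  have hXX : X * Xᵀ = D := by
    ext a b
    simp only [mul_apply, transpose_apply, hXij, D, diagonal_apply]
    by_cases ha : m ≤ a + r + 1
    · rw [Finset.sum_eq_single ⟨n + m - (a + r + 2), by omega⟩]
      · rw [if_pos (by simp only; omega), one_mul, if_pos ha]
        congr 1
        rw [Fin.ext_iff]
        exact propext (by simp only; omega)
      · intro c _ hc
        rw [if_neg, zero_mul]
        exact fun h => hc (Fin.ext (by simp only; omega))
      · simp
    · rw [Finset.sum_eq_zero, if_neg ha, ite_self]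
      intro c _
      rw [if_neg (by omega), zero_mul]
  have hDX : D * X = X := by
    ext a b
    simp only [D, diagonal_mul, hXij]
    split_ifs <;> first | omega | simp
  apply le_antisymm
  · rw [← hD, ← hDX]
    exact rank_mul_le_left D X
  · rw [← hD, ← hXX]
    exact rank_mul_le_left X Xᵀ

/-- The rank of the last row, cut into blocks, is constant on double cosets. -/
theorem rank_rowBlocks_of_mem_dCoset {k : Type*} [Field k] {m n : ℕ} {z : Fin (m * n)}
    (hz : (z : ℕ) = m * n - 1) {A B : Matrix (Fin (m * n)) (Fin (m * n)) k}
    (hA : A ∈ dCoset k m n B) : (rowBlocks z A).rank = (rowBlocks z B).rank := by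
  obtain ⟨p, hp, _, ⟨h, g, hh, hg, rfl⟩, rfl⟩ := hA
  have hpB : rowBlocks z (p * B) = p z z • rowBlocks z B := by
    ext i j
    exact congrFun (row_mul_of_mem_ParabP hp hz B) _
  rw [rowBlocks_mul_kron, rank_mul_eq_left_of_isUnit_det _ _ hg,
    rank_mul_eq_right_of_isUnit_det _ _ (by rwa [det_transpose]), hpB,
    rank_smul_of_mem_nonZeroDivisors _
      (mem_nonZeroDivisors_of_ne_zero (apply_last_ne_zero_of_mem_ParabP hp hz))]

theorem mem_dCoset_of_rank_eq {k : Type*} [Field k] {m n : ℕ} {z : Fin (m * n)}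
    (hz : (z : ℕ) = m * n - 1) {A B : Matrix (Fin (m * n)) (Fin (m * n)) k}
    (hA : IsUnit A.det) (hB : IsUnit B.det)
    (hAB : (rowBlocks z A).rank = (rowBlocks z B).rank) : A ∈ dCoset k m n B := by
  obtain ⟨h, g, hh, hg, hhg⟩ := exists_mul_mul_eq_of_rank_eq _ _ hAB
  have hh' : IsUnit hᵀ.det := by rwa [det_transpose]
  have hBt : IsUnit (B * kron hᵀ g).det := by
    rw [det_mul]
    exact hB.mul (isUnit_det_kron hh' hg)
  obtain ⟨p, hp, hpA⟩ := exists_mem_ParabP_of_row_eq hA hBt hz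
    (rowBlocks_inj (by rw [rowBlocks_mul_kron, transpose_transpose, hhg]))
  exact ⟨p, hp, kron hᵀ g, ⟨hᵀ, g, hh', hg, rfl⟩, by rw [hpA, Matrix.mul_assoc]⟩

theorem self_mem_dCoset {k : Type*} [Field k] {m n : ℕ}
    (A : Matrix (Fin (m * n)) (Fin (m * n)) k) : A ∈ dCoset k m n A :=
  ⟨1, one_mem_ParabP k _, 1, ⟨1, 1, by simp, by simp, kron_one_one.symm⟩, by simp⟩

theorem rank_rowBlocks_pos {k : Type*} [Field k] {m n : ℕ} (z : Fin (m * n))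
    {A : Matrix (Fin (m * n)) (Fin (m * n)) k} (hA : IsUnit A.det) :
    0 < (rowBlocks z A).rank := by
  rw [Nat.pos_iff_ne_zero]
  intro hrank
  have h0 : rowBlocks z A = 0 := by
    obtain ⟨h, g, -, -, hhg⟩ :=
      exists_mul_mul_eq_of_rank_eq (rowBlocks z A) 0 (hrank.trans rank_zero.symm)
    simpa using hhg
  refine hA.ne_zero (det_eq_zero_of_row_eq_zero z (congrFun (?_ : A z = 0)))
  exact rowBlocks_inj (B := 0) h0

/-- The double cosets `P_{mn−1,1}(k)·ε_r·T_{m,n}(k)`, `0 ≤ r ≤ n−1`, are pairwise distinct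
and their union is all of `GL_{mn}(k)`; so the double coset space has exactly `n` elements,
with representatives `ε_0, …, ε_{n−1}`. -/
theorem statement1 (k : Type*) [Field k] (m n : ℕ) (hn : 1 ≤ n) (hnm : n ≤ m) :
    (∀ r l : ℕ, r ≤ n - 1 → l ≤ n - 1 → r ≠ l →
      dCoset k m n (epsMat k m n r) ≠ dCoset k m n (epsMat k m n l)) ∧
    (∀ A : Matrix (Fin (m * n)) (Fin (m * n)) k, IsUnit A.det →
      ∃ r ≤ n - 1, A ∈ dCoset k m n (epsMat k m n r)) := by
  have hN : 0 < m * n := Nat.mul_pos (by omega) hn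
  obtain ⟨z, hz⟩ : ∃ z : Fin (m * n), (z : ℕ) = m * n - 1 := ⟨⟨m * n - 1, by omega⟩, rfl⟩
  refine ⟨fun r l hr hl hrl heq => hrl ?_, fun A hA => ?_⟩
  · have hmem : epsMat k m n r ∈ dCoset k m n (epsMat k m n l) := heq ▸ self_mem_dCoset _
    have hrank := rank_rowBlocks_of_mem_dCoset hz hmem
    rw [rank_rowBlocks_epsMat (by omega) hnm hz, rank_rowBlocks_epsMat (by omega) hnm hz] at hrank
    omega
  · have hpos := rank_rowBlocks_pos z hA
    have hle := rank_le_width (rowBlocks z A)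
    refine ⟨(rowBlocks z A).rank - 1, by omega, mem_dCoset_of_rank_eq hz hA
      (isUnit_det_epsMat k hn (by omega)) ?_⟩
    rw [rank_rowBlocks_epsMat (by omega) hnm hz]
    omega
end

section
/- Let k be a field, m ≥ n ≥ 1, and 0 ≤ r ≤ n−1. Let v ∈ k^{mn} be the row vector (0_n, …, 0_n, e_n, e_{n−1}, …, e_{n−r}), consisting of m−r−1 zero blocks 0_n ∈ k^n followed by the standard basis row vectors e_n, e_{n−1}, …, e_{n−r} of k^n. Then for h ∈ GL_m(k) and g ∈ GL_n(k), there exists λ ∈ k^× with v·t(h,g) = λ·v if and only if t(h,g) ∈ t_Δ(P^m_{r+1}, P^n_{r+1})(k). -/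
open Matrix

/-- The antidiagonal permutation matrix `w̃` (1's on the antidiagonal). -/
def antidiag (k : Type*) [Field k] (N : ℕ) : Matrix (Fin N) (Fin N) k :=
  Matrix.of fun i j => if (i : ℕ) + (j : ℕ) + 1 = N then 1 else 0

/-- `t_Δ(P^m_{r+1}, P^n_{r+1})(k)`: Kronecker products `t(h,g)` where
`h = ((A,B),(0,λ·d*)) ∈ GL_m(k)`, `g = ((a,b),(0,d)) ∈ GL_n(k)` with `d ∈ GL_{r+1}(k)`,
`λ ∈ k^×`, and `d* = w̃⁻¹·(dᵀ)⁻¹·w̃`. -/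
def tDelta (k : Type*) [Field k] (m n r : ℕ) :
    Set (Matrix (Fin (m * n)) (Fin (m * n)) k) :=
  {X | ∃ (h : Matrix (Fin m) (Fin m) k) (g : Matrix (Fin n) (Fin n) k)
        (d : Matrix (Fin (r + 1)) (Fin (r + 1)) k) (lam : kˣ),
      X = kron h g ∧ IsUnit h.det ∧ IsUnit g.det ∧ IsUnit d.det ∧
      (∀ i j : Fin m, m - (r + 1) ≤ (i : ℕ) → (j : ℕ) < m - (r + 1) → h i j = 0) ∧
      (∀ i j : Fin n, n - (r + 1) ≤ (i : ℕ) → (j : ℕ) < n - (r + 1) → g i j = 0) ∧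
      (∀ (i j : Fin m) (i' j' : Fin (r + 1)),
        (i : ℕ) = m - (r + 1) + (i' : ℕ) → (j : ℕ) = m - (r + 1) + (j' : ℕ) →
        h i j = (lam : k) *
          ((antidiag k (r + 1))⁻¹ * (d.transpose)⁻¹ * antidiag k (r + 1)) i' j') ∧
      (∀ (i j : Fin n) (i' j' : Fin (r + 1)),
        (i : ℕ) = n - (r + 1) + (i' : ℕ) → (j : ℕ) = n - (r + 1) + (j' : ℕ) →
        g i j = d i' j')}

theorem vecMul_kron_eq_smul_iff {k : Type*} [Field k] {m n : ℕ} (v : Fin (m * n) → k)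
    (h : Matrix (Fin m) (Fin m) k) (g : Matrix (Fin n) (Fin n) k) (c : k) :
    v ᵥ* kron h g = c • v ↔
      hᵀ * (Matrix.of fun i j => v (finProdFinEquiv (i, j))) * g =
        c • Matrix.of fun i j => v (finProdFinEquiv (i, j)) := by
  have key : ∀ i j, (v ᵥ* kron h g) (finProdFinEquiv (i, j)) =
      (hᵀ * (Matrix.of fun i j => v (finProdFinEquiv (i, j))) * g) i j := by
    intro i j
    have hij := finProdFinEquiv.symm_apply_apply (i, j)
    rw [finProdFinEquiv_symm_apply, Prod.mk.injEq] at hij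
    simp only [Matrix.vecMul, dotProduct, Matrix.mul_apply, kron, Matrix.of_apply, hij.1, hij.2,
      Matrix.transpose_apply, Finset.sum_mul]
    rw [← finProdFinEquiv.sum_comp, Fintype.sum_prod_type, Finset.sum_comm]
    refine Finset.sum_congr rfl fun q _ => Finset.sum_congr rfl fun p _ => ?_
    have hpq := finProdFinEquiv.symm_apply_apply (p, q)
    rw [finProdFinEquiv_symm_apply, Prod.mk.injEq] at hpq
    rw [hpq.1, hpq.2]
    ring
  constructor
  · intro H
    ext i j
    rw [← key, H]
    rfl
  · intro H
    ext x
    obtain ⟨⟨i, j⟩, rfl⟩ := finProdFinEquiv.surjective x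
    rw [key, H]
    rfl

theorem antidiag_mul_self (k : Type*) [Field k] (N : ℕ) : antidiag k N * antidiag k N = 1 := by
  ext i j
  rw [Matrix.mul_apply, Finset.sum_eq_single i.rev]
  · simp only [antidiag, Matrix.of_apply, Fin.val_rev, Matrix.one_apply, Fin.ext_iff]
    rw [if_pos (by omega), one_mul]
    exact if_congr (by omega) rfl rfl
  · intro l _ hl
    have : ¬ ((i : ℕ) + l + 1 = N) := fun e => hl (Fin.ext (by rw [Fin.val_rev]; omega))
    simp [antidiag, this]
  · simp

theorem antidiag_transpose (k : Type*) [Field k] (N : ℕ) : (antidiag k N)ᵀ = antidiag k N := by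
  ext i j
  simp [antidiag, add_comm]

theorem antidiag_inv (k : Type*) [Field k] (N : ℕ) : (antidiag k N)⁻¹ = antidiag k N :=
  Matrix.inv_eq_right_inv (antidiag_mul_self k N)

/-- The stabilizer of the line spanned by `((0, 0), (0, J))` under `V ↦ hᵀ V g`, where `J` is an
invertible square block. -/
theorem transpose_mul_fromBlocks_mul_eq_smul_iff {k α β σ : Type*} [Field k] [Fintype α]
    [Fintype β] [Fintype σ] [DecidableEq σ] (A : Matrix α α k) (B : Matrix α σ k)
    (C : Matrix σ α k) (D : Matrix σ σ k) (a : Matrix β β k) (b : Matrix β σ k)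
    (c : Matrix σ β k) (d : Matrix σ σ k) (J : Matrix σ σ k) (hJ : IsUnit J) (lam : kˣ) :
    (fromBlocks A B C D)ᵀ * fromBlocks (0 : Matrix α β k) 0 0 J * fromBlocks a b c d =
        (lam : k) • fromBlocks 0 0 0 J ↔
      C = 0 ∧ c = 0 ∧ Dᵀ * J * d = (lam : k) • J := by
  rw [fromBlocks_transpose, fromBlocks_multiply, fromBlocks_multiply, fromBlocks_smul,
    fromBlocks_inj]
  simp only [Matrix.mul_zero, Matrix.zero_mul, zero_add, add_zero, smul_zero]
  constructor
  · rintro ⟨-, h₁₂, h₂₁, h₂₂⟩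
    have hu : IsUnit (Dᵀ * J * d) := by
      rw [h₂₂, ← Units.smul_def]
      exact hJ.smul lam
    have hd : IsUnit d.det := by
      rw [Matrix.isUnit_iff_isUnit_det, Matrix.det_mul] at hu
      exact isUnit_of_mul_isUnit_right hu
    have hDJ : IsUnit (Dᵀ * J).det := by
      rw [Matrix.isUnit_iff_isUnit_det, Matrix.det_mul] at hu
      exact isUnit_of_mul_isUnit_left hu
    have hJ' := (Matrix.isUnit_iff_isUnit_det J).1 hJ
    refine ⟨?_, ?_, h₂₂⟩
    · have h₁ : Cᵀ * J = 0 := by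
        rw [← Matrix.mul_nonsing_inv_cancel_right d (Cᵀ * J) hd, h₁₂, Matrix.zero_mul]
      rw [← Matrix.transpose_eq_zero, ← Matrix.mul_nonsing_inv_cancel_right J Cᵀ hJ', h₁,
        Matrix.zero_mul]
    · rw [← Matrix.nonsing_inv_mul_cancel_left (Dᵀ * J) c hDJ, h₂₁, Matrix.mul_zero]
  · rintro ⟨rfl, rfl, h₂₂⟩
    simp [h₂₂]

/-- The equation `Dᵀ J d = λ J` determines `D` as `λ d*`. -/
theorem transpose_mul_antidiag_mul_eq_smul_iff {k : Type*} [Field k] {N : ℕ}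
    (D d : Matrix (Fin N) (Fin N) k) (lam : kˣ) :
    Dᵀ * antidiag k N * d = (lam : k) • antidiag k N ↔
      IsUnit d.det ∧ D = (lam : k) • ((antidiag k N)⁻¹ * dᵀ⁻¹ * antidiag k N) := by
  have hJJ := antidiag_mul_self k N
  have hJT := antidiag_transpose k N
  rw [antidiag_inv]
  constructor
  · intro H
    have hd : IsUnit d := by
      refine IsUnit.of_mul_eq_one (((lam⁻¹ : kˣ) : k) • (antidiag k N * Dᵀ * antidiag k N)) ?_
      rw [mul_eq_one_comm, Matrix.smul_mul, Matrix.mul_assoc, Matrix.mul_assoc,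
        ← Matrix.mul_assoc Dᵀ, H, Matrix.mul_smul, hJJ, smul_smul, Units.inv_mul, one_smul]
    rw [Matrix.isUnit_iff_isUnit_det] at hd
    refine ⟨hd, ?_⟩
    have h₁ : Dᵀ = (lam : k) • (antidiag k N * d⁻¹ * antidiag k N) := by
      calc Dᵀ = Dᵀ * antidiag k N * d * d⁻¹ * antidiag k N := by
            rw [Matrix.mul_nonsing_inv_cancel_right d _ hd, Matrix.mul_assoc, hJJ, Matrix.mul_one]
        _ = _ := by rw [H, Matrix.smul_mul, Matrix.smul_mul]
    rw [← Matrix.transpose_transpose D, h₁]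
    simp only [Matrix.transpose_smul, Matrix.transpose_mul, hJT, Matrix.transpose_nonsing_inv,
      Matrix.mul_assoc]
  · rintro ⟨hd, rfl⟩
    simp only [Matrix.transpose_smul, Matrix.transpose_mul, hJT, Matrix.transpose_nonsing_inv,
      Matrix.transpose_transpose, Matrix.smul_mul]
    rw [Matrix.mul_assoc (antidiag k N), Matrix.mul_assoc (antidiag k N),
      Matrix.mul_assoc d⁻¹, hJJ, Matrix.mul_one, Matrix.nonsing_inv_mul d hd, Matrix.mul_one]

theorem vecMul_kron_eq_smul_iff_blocks {k : Type*} [Field k] {a b r : ℕ}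
    (v : Fin ((a + (r + 1)) * (b + (r + 1))) → k)
    (hv : ∀ i, v i = if (i : ℕ) / (b + (r + 1)) + (i : ℕ) % (b + (r + 1)) + r + 2 =
      b + (r + 1) + (a + (r + 1)) then 1 else 0)
    (h : Matrix (Fin (a + (r + 1))) (Fin (a + (r + 1))) k)
    (g : Matrix (Fin (b + (r + 1))) (Fin (b + (r + 1))) k) (lam : kˣ) :
    v ᵥ* kron h g = (lam : k) • v ↔
      h.submatrix (Fin.natAdd a) (Fin.castAdd (r + 1)) = 0 ∧
      g.submatrix (Fin.natAdd b) (Fin.castAdd (r + 1)) = 0 ∧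
      IsUnit (g.submatrix (Fin.natAdd b) (Fin.natAdd b)).det ∧
      h.submatrix (Fin.natAdd a) (Fin.natAdd a) = (lam : k) • ((antidiag k (r + 1))⁻¹ *
        (g.submatrix (Fin.natAdd b) (Fin.natAdd b))ᵀ⁻¹ * antidiag k (r + 1)) := by
  set V : Matrix (Fin (a + (r + 1))) (Fin (b + (r + 1))) k :=
    Matrix.of fun i j => v (finProdFinEquiv (i, j)) with hVdef
  have hV : V.submatrix finSumFinEquiv finSumFinEquiv =
      fromBlocks 0 0 0 (antidiag k (r + 1)) := by
    have entry : ∀ i j, V i j = if (i : ℕ) + j + r + 2 = b + (r + 1) + (a + (r + 1))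
        then 1 else 0 := by
      intro i j
      have hij := finProdFinEquiv.symm_apply_apply (i, j)
      rw [finProdFinEquiv_symm_apply, Prod.mk.injEq] at hij
      have h₁ := congrArg Fin.val hij.1
      have h₂ := congrArg Fin.val hij.2
      rw [Fin.coe_divNat] at h₁
      rw [Fin.coe_modNat] at h₂
      rw [hVdef, Matrix.of_apply, hv, h₁, h₂]
    ext (i | i) (j | j) <;>
      simp only [Matrix.submatrix_apply, finSumFinEquiv_apply_left, finSumFinEquiv_apply_right,
        entry, fromBlocks_apply₁₁, fromBlocks_apply₁₂, fromBlocks_apply₂₁, fromBlocks_apply₂₂,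
        Fin.val_castAdd, Fin.val_natAdd, Matrix.zero_apply, antidiag, Matrix.of_apply]
    · exact if_neg (by omega)
    · exact if_neg (by omega)
    · exact if_neg (by omega)
    · exact if_congr (by omega) rfl rfl
  have hblocks : ∀ {c : ℕ} (M : Matrix (Fin (c + (r + 1))) (Fin (c + (r + 1))) k),
      M.submatrix finSumFinEquiv finSumFinEquiv =
        fromBlocks (M.submatrix (Fin.castAdd (r + 1)) (Fin.castAdd (r + 1)))
          (M.submatrix (Fin.castAdd (r + 1)) (Fin.natAdd c))
          (M.submatrix (Fin.natAdd c) (Fin.castAdd (r + 1)))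
          (M.submatrix (Fin.natAdd c) (Fin.natAdd c)) := by
    intro c M
    ext (i | i) (j | j) <;> simp
  have hJ : IsUnit (antidiag k (r + 1)) := IsUnit.of_mul_eq_one _ (antidiag_mul_self k _)
  rw [← transpose_mul_antidiag_mul_eq_smul_iff, vecMul_kron_eq_smul_iff,
    ← transpose_mul_fromBlocks_mul_eq_smul_iff
      (h.submatrix (Fin.castAdd (r + 1)) (Fin.castAdd (r + 1)))
      (h.submatrix (Fin.castAdd (r + 1)) (Fin.natAdd a)) _ _
      (g.submatrix (Fin.castAdd (r + 1)) (Fin.castAdd (r + 1)))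
      (g.submatrix (Fin.castAdd (r + 1)) (Fin.natAdd b)) _ _ _ hJ,
    ← hblocks, ← hblocks, ← hV, ← hVdef, Matrix.transpose_submatrix,
    Matrix.submatrix_mul_equiv, Matrix.submatrix_mul_equiv]
  exact ((Matrix.reindex finSumFinEquiv.symm finSumFinEquiv.symm).injective.eq_iff
    (a := hᵀ * V * g) (b := (lam : k) • V)).symm

/-- Let `v ∈ k^{mn}` be the row vector `(0_n,…,0_n,e_n,e_{n−1},…,e_{n−r})` (with `m−r−1`
zero blocks). For `h ∈ GL_m(k)`, `g ∈ GL_n(k)`: there is `λ ∈ k^×` with `v·t(h,g) = λ·v`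
iff `t(h,g) ∈ t_Δ(P^m_{r+1}, P^n_{r+1})(k)`. -/
theorem statement9 (k : Type*) [Field k] (m n r : ℕ) (hn : 1 ≤ n) (hnm : n ≤ m)
    (hr : r ≤ n - 1)
    (v : Fin (m * n) → k)
    (hv : ∀ i : Fin (m * n),
      v i = if (i : ℕ) / n + (i : ℕ) % n + r + 2 = n + m then 1 else 0)
    (h : Matrix (Fin m) (Fin m) k) (g : Matrix (Fin n) (Fin n) k)
    (hh : IsUnit h.det) (hg : IsUnit g.det) :
    (∃ lam : kˣ, Matrix.vecMul v (kron h g) = (lam : k) • v) ↔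
      kron h g ∈ tDelta k m n r := by
  obtain ⟨a, rfl⟩ : ∃ a, m = a + (r + 1) := ⟨m - (r + 1), by omega⟩
  obtain ⟨b, rfl⟩ : ∃ b, n = b + (r + 1) := ⟨n - (r + 1), by omega⟩
  simp only [tDelta, Set.mem_ofPred_eq, Nat.add_sub_cancel]
  constructor
  · rintro ⟨lam, hlam⟩
    obtain ⟨hC, hc, hd, hD⟩ := (vecMul_kron_eq_smul_iff_blocks v hv h g lam).1 hlam
    refine ⟨h, g, _, lam, rfl, hh, hg, hd, fun i j hi hj => ?_, fun i j hi hj => ?_,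
      fun i j i' j' hi hj => ?_, fun i j i' j' hi hj => ?_⟩
    · obtain ⟨i, rfl⟩ : ∃ i', Fin.natAdd a i' = i :=
        ⟨⟨i - a, by omega⟩, Fin.ext (Nat.add_sub_cancel' hi)⟩
      exact congrFun (congrFun hC i) ⟨j, hj⟩
    · obtain ⟨i, rfl⟩ : ∃ i', Fin.natAdd b i' = i :=
        ⟨⟨i - b, by omega⟩, Fin.ext (Nat.add_sub_cancel' hi)⟩
      exact congrFun (congrFun hc i) ⟨j, hj⟩
    · obtain rfl : i = Fin.natAdd a i' := Fin.ext hi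
      obtain rfl : j = Fin.natAdd a j' := Fin.ext hj
      exact congrFun (congrFun hD i') j'
    · obtain rfl : i = Fin.natAdd b i' := Fin.ext hi
      obtain rfl : j = Fin.natAdd b j' := Fin.ext hj
      rfl
  · rintro ⟨h', g', d, lam, heq, -, -, hd, hC, hc, hD, hdg⟩
    have hd' : g'.submatrix (Fin.natAdd b) (Fin.natAdd b) = d := by
      ext i j
      exact hdg _ _ i j rfl rfl
    refine ⟨lam, ?_⟩
    rw [heq, vecMul_kron_eq_smul_iff_blocks v hv, hd']
    refine ⟨?_, ?_, hd, ?_⟩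
    · ext i j
      exact hC _ _ (by simp) (by simp)
    · ext i j
      exact hc _ _ (by simp) (by simp)
    · ext i j
      exact hD _ _ i j rfl rfl
end
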